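/- For each d ≥ 1 let M_d be the uncentered maximal operator on ℝ^d associated to euclidean (ℓ₂) balls, with distances measured in the ℓ₂ norm, and fix the same modulus of continuity ω for every dimension. Then: (i) liminf_{d→∞} ‖M_d‖_{Op(ω)} ≥ sup_{t>0} ω(t/√2)/ω(t); (ii) limsup_{d→∞} ‖M_d‖_{Op(ω)} ≤ inf_{r>1} sup_{t>0} ω(rt/√2)/ω(t); (iii) if moreover ω is concave, then for every d ≥ 1, ‖M_d‖_{Op(ω)} ≤ sup_{t>0} ω(t/√2)/ω(t), and lim_{d→∞} ‖M_d‖_{Op(ω)} = sup_{t>0} ω(t/√2)/ω(t). In particular, for ω(t) = t^α with α ∈ (0,1], ‖M_d‖_{Op(α)} ≤ 2^{−α/2} for all d ≥ 1 and lim_{d→∞} ‖M_d‖_{Op(α)} = 2^{−α/2}. -/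

import Mathlib

open MeasureTheory Set Filter Topology

/-- The closed ball of the norm-like function `N`, with center `c` and radius `R`. -/
def nball {d : ℕ} (N : (Fin d → ℝ) → ℝ) (c : Fin d → ℝ) (R : ℝ) : Set (Fin d → ℝ) :=
  {y | N (y - c) ≤ R}

/-- The uncentered Hardy–Littlewood maximal function associated to the norm `N`,
with respect to `d`-dimensional Lebesgue measure. -/
noncomputable def maxFn {d : ℕ} (N : (Fin d → ℝ) → ℝ) (f : (Fin d → ℝ) → ℝ)
    (x : Fin d → ℝ) : ℝ :=
  sSup {a : ℝ | ∃ c : Fin d → ℝ, ∃ R : ℝ, 0 < R ∧ x ∈ nball N c R ∧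
    a = ⨍ y in nball N c R, |f y|}

/-- The modulus of continuity of `g`, with distances measured using `N`. -/
noncomputable def modCont {d : ℕ} (N : (Fin d → ℝ) → ℝ) (g : (Fin d → ℝ) → ℝ) (δ : ℝ) : ℝ :=
  sSup {a : ℝ | ∃ x y : Fin d → ℝ, N (x - y) ≤ δ ∧ a = |g x - g y|}

/-- `N` is a norm on `ℝ^d`. -/
structure IsNorm {d : ℕ} (N : (Fin d → ℝ) → ℝ) : Prop where
  eq_zero_iff : ∀ x, N x = 0 ↔ x = 0
  add_le : ∀ x y, N (x + y) ≤ N x + N y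
  smul : ∀ (a : ℝ) (x), N (a • x) = |a| * N x

/-- `ω` is a modulus of continuity: continuous, nondecreasing, subadditive on `[0,∞)`,
vanishing at `0`, nonnegative, and not identically zero. -/
structure IsModulus (ω : ℝ → ℝ) : Prop where
  nonneg : ∀ t, 0 ≤ t → 0 ≤ ω t
  map_zero : ω 0 = 0
  mono : MonotoneOn ω (Ici 0)
  subadd : ∀ a b, 0 ≤ a → 0 ≤ b → ω (a + b) ≤ ω a + ω b
  cont : ContinuousOn ω (Ici 0)
  nontrivial : ∃ t, 0 < t ∧ ω t ≠ 0

/-- The `Lip(ω)` seminorm of `f`: `sup_{t>0} ω(f,t)/ω(t)`. -/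
noncomputable def lipNorm {d : ℕ} (N : (Fin d → ℝ) → ℝ) (ω : ℝ → ℝ)
    (f : (Fin d → ℝ) → ℝ) : ℝ :=
  sSup {a : ℝ | ∃ t : ℝ, 0 < t ∧ a = modCont N f t / ω t}

/-- The operator norm of the uncentered maximal operator on `Lip(ω)`. -/
noncomputable def opNorm (d : ℕ) (N : (Fin d → ℝ) → ℝ) (ω : ℝ → ℝ) : ℝ :=
  sSup {a : ℝ | ∃ f : (Fin d → ℝ) → ℝ, lipNorm N ω f = 1 ∧ a = lipNorm N ω (maxFn N f)}

/-- The Hölder `α` seminorm of `f`, distances measured with `N`. -/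
noncomputable def holderNorm {d : ℕ} (N : (Fin d → ℝ) → ℝ) (α : ℝ)
    (f : (Fin d → ℝ) → ℝ) : ℝ :=
  sSup {a : ℝ | ∃ x y : Fin d → ℝ, x ≠ y ∧ a = |f x - f y| / N (x - y) ^ α}

/-- The operator norm of the uncentered maximal operator on the Hölder class `Lip_α`. -/
noncomputable def opNormHolder (d : ℕ) (N : (Fin d → ℝ) → ℝ) (α : ℝ) : ℝ :=
  sSup {a : ℝ | ∃ f : (Fin d → ℝ) → ℝ, holderNorm N α f = 1 ∧
    a = holderNorm N α (maxFn N f)}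

/-- The operator norm, on `Lip(ω)` for `ℓ₂` distances, of the uncentered maximal operator
associated to euclidean balls in dimension `d`. -/
noncomputable def op2 (ω : ℝ → ℝ) (d : ℕ) : ℝ :=
  opNorm d (fun x => Real.sqrt (∑ i, x i ^ 2)) ω

section UnitBall

variable {E : Type*} [NormedAddCommGroup E] [InnerProductSpace ℝ E] [FiniteDimensional ℝ E]
  [MeasurableSpace E] [BorelSpace E]

variable (E) in
/-- The uniform probability measure on the closed unit ball. -/
noncomputable def unitBallMeasure : Measure E :=
  (volume.restrict (Metric.closedBall (0 : E) 1) univ)⁻¹ •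
    volume.restrict (Metric.closedBall (0 : E) 1)


lemma volume_closedBall_ne_zero (c : E) {R : ℝ} (hR : 0 < R) :
    volume (Metric.closedBall c R) ≠ 0 :=
  (Metric.measure_closedBall_pos _ _ hR).ne'

lemma volume_closedBall_ne_top (c : E) (R : ℝ) :
    volume (Metric.closedBall c R) ≠ ⊤ :=
  measure_closedBall_lt_top.ne

instance : IsProbabilityMeasure (unitBallMeasure E) := by
  constructor
  have h0 := volume_closedBall_ne_zero (0 : E) one_pos
  have h1 := volume_closedBall_ne_top (0 : E) 1
  simp [unitBallMeasure, ENNReal.inv_mul_cancel h0 h1]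

lemma ae_norm_le_one : ∀ᵐ u ∂unitBallMeasure E, ‖u‖ ≤ 1 := by
  refine Measure.ae_smul_measure ?_ _
  filter_upwards [ae_restrict_mem Metric.isClosed_closedBall.measurableSet] with u hu
  simpa using hu

lemma integrable_unitBallMeasure {g : E → ℝ} (hg : Continuous g) :
    Integrable g (unitBallMeasure E) := by
  refine Integrable.smul_measure ?_ ?_
  · exact hg.continuousOn.integrableOn_compact (isCompact_closedBall _ _)
  · simpa using (Metric.measure_closedBall_pos volume (0 : E) one_pos).ne'

lemma integral_mono_unitBallMeasure {g h : E → ℝ} (hg : Continuous g)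
    (hh : Integrable h (unitBallMeasure E)) (hgh : ∀ u, ‖u‖ ≤ 1 → g u ≤ h u) :
    ∫ u, g u ∂unitBallMeasure E ≤ ∫ u, h u ∂unitBallMeasure E :=
  integral_mono_ae (integrable_unitBallMeasure hg) hh (ae_norm_le_one.mono hgh)

lemma setAverage_closedBall (g : E → ℝ) (c : E) {R : ℝ} (hR : 0 < R) :
    ⨍ v in Metric.closedBall c R, g v = ∫ u, g (c + R • u) ∂unitBallMeasure E := by
  have h1 : ∫ v in Metric.closedBall c R, g v
      = ∫ v in Metric.closedBall (0 : E) R, g (c + v) := by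
    rw [← (measurePreserving_add_left volume c).setIntegral_preimage_emb
      (measurableEmbedding_addLeft c)]
    congr 2
    simp
  have h2 := Measure.setIntegral_comp_smul_of_pos (volume : Measure E) (fun v => g (c + v))
    (Metric.closedBall 0 1) hR
  rw [smul_unitClosedBall, Real.norm_of_nonneg hR.le] at h2
  rw [unitBallMeasure, ← average_eq', setAverage_eq, setAverage_eq, h2, h1,
    Measure.addHaar_real_closedBall' _ _ hR.le]
  simp only [smul_eq_mul, mul_inv]
  ring

lemma measurePreserving_unitBallMeasure (L : E ≃ₗᵢ[ℝ] E) :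
    MeasurePreserving L (unitBallMeasure E) (unitBallMeasure E) := by
  have h := L.measurePreserving.restrict_preimage
    (s := Metric.closedBall (0 : E) 1) Metric.isClosed_closedBall.measurableSet
  have h2 : L ⁻¹' Metric.closedBall (0 : E) 1 = Metric.closedBall (0 : E) 1 := by
    ext; simp
  rw [h2] at h
  exact h.smul_measure _

lemma integral_comp_unitBallMeasure (L : E ≃ₗᵢ[ℝ] E) (g : E → ℝ) :
    ∫ u, g (L u) ∂unitBallMeasure E = ∫ u, g u ∂unitBallMeasure E :=
  (measurePreserving_unitBallMeasure L).integral_comp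
    L.toHomeomorph.measurableEmbedding g

lemma integral_inner_unitBallMeasure (e : E) :
    ∫ u, inner ℝ e u ∂unitBallMeasure E = 0 := by
  have h := integral_comp_unitBallMeasure (LinearIsometryEquiv.neg ℝ (E := E))
    (fun u => inner ℝ e u)
  simp only [LinearIsometryEquiv.coe_neg, inner_neg_right, integral_neg] at h
  linarith

lemma integral_inner_sq_unitBallMeasure_le {e : E} (he : ‖e‖ = 1) :
    ∫ u, (inner ℝ e u) ^ 2 ∂unitBallMeasure E ≤ 1 / Module.finrank ℝ E := by
  let b := stdOrthonormalBasis ℝ E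
  have hb : ∀ i, ∫ u, (inner ℝ (b i) u) ^ 2 ∂unitBallMeasure E
      = ∫ u, (inner ℝ e u) ^ 2 ∂unitBallMeasure E := by
    intro i
    let L := (ℝ ∙ (b i - e))ᗮ.reflection
    have hL : L (b i) = e := Submodule.reflection_sub (by simp [he])
    rw [← integral_comp_unitBallMeasure L (fun u => (inner ℝ e u) ^ 2)]
    simp only [← hL, LinearIsometryEquiv.inner_map_map]
  have hsum : ∑ i, ∫ u, (inner ℝ (b i) u) ^ 2 ∂unitBallMeasure E ≤ 1 := by
    rw [← integral_finsetSum _ fun i _ => integrable_unitBallMeasure (by fun_prop)]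
    refine (integral_mono_unitBallMeasure (h := fun _ => 1) (by fun_prop)
      (integrable_const _) fun u hu => ?_).trans (by simp)
    rw [b.sum_sq_inner_right]
    nlinarith [norm_nonneg u]
  simp only [hb, Finset.sum_const, Finset.card_univ, Fintype.card_fin, nsmul_eq_mul] at hsum
  have hne : e ≠ 0 := by rintro rfl; simp at he
  have : Nontrivial E := nontrivial_of_ne e 0 hne
  have : 0 < (Module.finrank ℝ E : ℝ) := by exact_mod_cast Module.finrank_pos
  rw [le_div_iff₀ this]
  linarith

lemma unitBallMeasure_real_closedBall {s : ℝ} (hs : 0 ≤ s) (hs1 : s ≤ 1) :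
    (unitBallMeasure E).real (Metric.closedBall 0 s) = s ^ Module.finrank ℝ E := by
  have h0 := volume_closedBall_ne_zero (0 : E) one_pos
  have h1 := volume_closedBall_ne_top (0 : E) 1
  have h2 : volume.real (Metric.closedBall (0 : E) 1) ≠ 0 := by
    simp [measureReal_def, ENNReal.toReal_eq_zero_iff, h0, h1]
  rw [unitBallMeasure, measureReal_ennreal_smul_apply, measureReal_restrict_apply
    Metric.isClosed_closedBall.measurableSet,
    inter_eq_left.2 (Metric.closedBall_subset_closedBall hs1),
    Measure.addHaar_real_closedBall' _ _ hs, Measure.restrict_apply_univ, ENNReal.toReal_inv,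
    ← measureReal_def]
  field_simp

end UnitBall

namespace IsModulus

variable {ω : ℝ → ℝ}

lemma pos (hω : IsModulus ω) {t : ℝ} (ht : 0 < t) : 0 < ω t := by
  refine (hω.nonneg t ht.le).lt_of_ne fun h0 => ?_
  obtain ⟨s, hs, hs0⟩ := hω.nontrivial
  have hn : ∀ n : ℕ, ω (n * t) = 0 := by
    intro n
    induction n with
    | zero => simpa using hω.map_zero
    | succ n ih =>
      refine le_antisymm ?_ (hω.nonneg _ (by positivity))
      have := hω.subadd (n * t) t (by positivity) ht.le
      push_cast
      rw [add_mul, one_mul]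
      linarith
  obtain ⟨n, hn'⟩ := exists_nat_ge (s / t)
  rw [div_le_iff₀ ht] at hn'
  have := hω.mono (mem_Ici.2 hs.le) (mem_Ici.2 (hs.le.trans hn')) hn'
  rw [hn n] at this
  exact hs0 (le_antisymm this (hω.nonneg s hs.le))

lemma le_of_le (hω : IsModulus ω) {a b : ℝ} (ha : 0 ≤ a) (hab : a ≤ b) : ω a ≤ ω b :=
  hω.mono (mem_Ici.2 ha) (mem_Ici.2 (ha.trans hab)) hab

lemma sub_le (hω : IsModulus ω) {a b c : ℝ} (ha : 0 ≤ a) (hb : 0 ≤ b) (hc : 0 ≤ c)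
    (h : a ≤ b + c) : ω a - ω b ≤ ω c := by
  have h1 := hω.le_of_le ha h
  have h2 := hω.subadd b c hb hc
  linarith

lemma continuous_comp {X : Type*} [TopologicalSpace X] (hω : IsModulus ω) {g : X → ℝ}
    (hg : Continuous g) (h0 : ∀ x, 0 ≤ g x) : Continuous fun x => ω (g x) :=
  hω.cont.comp_continuous hg h0

lemma bddAbove_ratio (hω : IsModulus ω) {q : ℝ} (hq : 0 ≤ q) :
    BddAbove {c : ℝ | ∃ t : ℝ, 0 < t ∧ c = ω (q * t) / ω t} := by
  obtain ⟨n, hn⟩ := exists_nat_ge q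
  have key : ∀ m : ℕ, ∀ t : ℝ, 0 < t → ω (m * t) ≤ m * ω t := by
    intro m t ht
    induction m with
    | zero => simp [hω.map_zero]
    | succ m ih =>
      have := hω.subadd (m * t) t (by positivity) ht.le
      push_cast
      rw [add_mul, one_mul, add_mul, one_mul]
      linarith
  refine ⟨n, ?_⟩
  rintro _ ⟨t, ht, rfl⟩
  rw [div_le_iff₀ (hω.pos ht)]
  exact (hω.le_of_le (by positivity) (by gcongr)).trans (key n t ht)

end IsModulus

/-- The euclidean norm on `Fin d → ℝ`. -/
noncomputable def euclNorm {d : ℕ} (x : Fin d → ℝ) : ℝ := Real.sqrt (∑ i, x i ^ 2)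

section Euclidean

variable {d : ℕ} {ω : ℝ → ℝ} {f : (Fin d → ℝ) → ℝ}

lemma euclNorm_eq (x : Fin d → ℝ) : euclNorm x = ‖WithLp.toLp 2 x‖ := by
  simp [euclNorm, EuclideanSpace.norm_eq]

lemma euclNorm_ofLp (u : EuclideanSpace ℝ (Fin d)) : euclNorm u.ofLp = ‖u‖ := by
  simp [euclNorm_eq]

lemma euclNorm_nonneg (x : Fin d → ℝ) : 0 ≤ euclNorm x := Real.sqrt_nonneg _

lemma euclNorm_smul (a : ℝ) (x : Fin d → ℝ) : euclNorm (a • x) = |a| * euclNorm x := by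
  simp [euclNorm_eq, norm_smul]

lemma euclNorm_sub_comm (x y : Fin d → ℝ) : euclNorm (x - y) = euclNorm (y - x) := by
  simp [euclNorm_eq, norm_sub_rev]

lemma euclNorm_add_le (x y : Fin d → ℝ) : euclNorm (x + y) ≤ euclNorm x + euclNorm y := by
  simp only [euclNorm_eq, WithLp.toLp_add]
  exact norm_add_le _ _

lemma euclNorm_pos {x : Fin d → ℝ} (hx : x ≠ 0) : 0 < euclNorm x := by
  simpa [euclNorm_eq] using hx

lemma euclNorm_zero : euclNorm (0 : Fin d → ℝ) = 0 := by
  simp [euclNorm_eq]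

lemma continuous_euclNorm : Continuous (euclNorm : (Fin d → ℝ) → ℝ) := by
  unfold euclNorm
  fun_prop

lemma setAverage_nball (g : (Fin d → ℝ) → ℝ) (c : Fin d → ℝ) {R : ℝ} (hR : 0 < R) :
    ⨍ y in nball euclNorm c R, g y =
      ∫ u, g (c + R • u.ofLp) ∂unitBallMeasure (EuclideanSpace ℝ (Fin d)) := by
  have hpre : (WithLp.ofLp : EuclideanSpace ℝ (Fin d) → (Fin d → ℝ)) ⁻¹' nball euclNorm c R =
      Metric.closedBall (WithLp.toLp 2 c) R := by
    ext v
    simp [nball, euclNorm_eq, dist_eq_norm]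
  have hmeas : MeasurableSet (nball euclNorm c R) :=
    measurableSet_le (continuous_euclNorm.comp (continuous_sub_right c)).measurable
      measurable_const
  have hmp := PiLp.volume_preserving_ofLp (Fin d)
  have h := setAverage_closedBall (fun v : EuclideanSpace ℝ (Fin d) => g v.ofLp)
    (WithLp.toLp 2 c) hR
  simp only [WithLp.ofLp_add, WithLp.ofLp_smul] at h
  rw [← h, setAverage_eq, setAverage_eq, ← hpre,
    hmp.setIntegral_preimage_emb (MeasurableEquiv.toLp 2 (Fin d → ℝ)).symm.measurableEmbedding,
    hmp.measureReal_preimage hmeas.nullMeasurableSet]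

lemma abs_sub_le_of_lipNorm_eq_one (hω : IsModulus ω) (h : lipNorm euclNorm ω f = 1)
    (x y : Fin d → ℝ) : |f x - f y| ≤ ω (euclNorm (x - y)) := by
  set D : ℝ → Set ℝ := fun t =>
    {a : ℝ | ∃ x y : Fin d → ℝ, euclNorm (x - y) ≤ t ∧ a = |f x - f y|} with hD
  have hbdd : BddAbove {a : ℝ | ∃ t : ℝ, 0 < t ∧ a = modCont euclNorm f t / ω t} := by
    by_contra hb
    rw [lipNorm, Real.sSup_of_not_bddAbove hb] at h
    exact zero_ne_one h
  have hmod : ∀ t, 0 < t → modCont euclNorm f t ≤ ω t := by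
    intro t ht
    have := le_csSup hbdd ⟨t, ht, rfl⟩
    rw [← lipNorm, h, div_le_one (hω.pos ht)] at this
    exact this
  have hmono : ∀ s t, s ≤ t → BddAbove (D t) → BddAbove (D s) := by
    intro s t hst hb
    refine hb.mono ?_
    rintro _ ⟨x, y, hxy, rfl⟩
    exact ⟨x, y, hxy.trans hst, rfl⟩
  have hdouble : ∀ t, BddAbove (D t) → BddAbove (D (2 * t)) := by
    rintro t ⟨M, hM⟩
    refine ⟨M + M, ?_⟩
    rintro _ ⟨x, y, hxy, rfl⟩
    have h1 : |f x - f ((1 / 2 : ℝ) • (x + y))| ≤ M := by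
      refine hM ⟨_, _, ?_, rfl⟩
      rw [show x - (1 / 2 : ℝ) • (x + y) = (1 / 2 : ℝ) • (x - y) by module, euclNorm_smul,
        abs_of_pos one_half_pos]
      linarith
    have h2 : |f ((1 / 2 : ℝ) • (x + y)) - f y| ≤ M := by
      refine hM ⟨_, _, ?_, rfl⟩
      rw [show (1 / 2 : ℝ) • (x + y) - y = (1 / 2 : ℝ) • (x - y) by module, euclNorm_smul,
        abs_of_pos one_half_pos]
      linarith
    exact (abs_sub_le _ _ _).trans (add_le_add h1 h2)
  obtain ⟨t, ht, htb⟩ : ∃ t, 0 < t ∧ BddAbove (D t) := by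
    by_contra! hn
    have : lipNorm euclNorm ω f ≤ 0 := by
      refine Real.sSup_nonpos ?_
      rintro _ ⟨t, ht, rfl⟩
      have : modCont euclNorm f t = 0 := Real.sSup_of_not_bddAbove (hn t ht)
      simp [this]
    linarith
  have hall : ∀ s, BddAbove (D s) := by
    intro s
    have hpow : ∀ n : ℕ, BddAbove (D (2 ^ n * t)) := by
      intro n
      induction n with
      | zero => simpa using htb
      | succ n ih => rw [pow_succ', mul_assoc]; exact hdouble _ ih
    obtain ⟨n, hn⟩ := pow_unbounded_of_one_lt (s / t) (one_lt_two : (1 : ℝ) < 2)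
    exact hmono s _ ((div_lt_iff₀ ht).1 hn).le (hpow n)
  rcases eq_or_ne x y with rfl | hxy
  · simp [euclNorm_zero, hω.map_zero]
  · exact (le_csSup (hall _) ⟨x, y, le_rfl, rfl⟩).trans
      (hmod _ (euclNorm_pos (sub_ne_zero.2 hxy)))

lemma modCont_le {C δ : ℝ} (hC : 0 ≤ C)
    (h : ∀ x y, euclNorm (x - y) ≤ δ → |f x - f y| ≤ C) : modCont euclNorm f δ ≤ C := by
  refine Real.sSup_le ?_ hC
  rintro _ ⟨x, y, hxy, rfl⟩
  exact h x y hxy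

lemma modCont_le_mul (hω : IsModulus ω) {C t : ℝ} (hC : 0 ≤ C) (ht : 0 < t)
    (h : ∀ x y, |f x - f y| ≤ C * ω (euclNorm (x - y))) :
    modCont euclNorm f t ≤ C * ω t :=
  modCont_le (mul_nonneg hC (hω.nonneg t ht.le)) fun x y hxy =>
    (h x y).trans (mul_le_mul_of_nonneg_left (hω.le_of_le (euclNorm_nonneg _) hxy) hC)

lemma lipNorm_le (hω : IsModulus ω) {C : ℝ} (hC : 0 ≤ C)
    (h : ∀ x y, |f x - f y| ≤ C * ω (euclNorm (x - y))) : lipNorm euclNorm ω f ≤ C := by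
  refine Real.sSup_le ?_ hC
  rintro _ ⟨t, ht, rfl⟩
  rw [div_le_iff₀ (hω.pos ht)]
  exact modCont_le_mul hω hC ht h

lemma le_lipNorm (hω : IsModulus ω) {C : ℝ} (hC : 0 ≤ C)
    (h : ∀ x y, |f x - f y| ≤ C * ω (euclNorm (x - y))) {x y : Fin d → ℝ} (hxy : x ≠ y) :
    |f x - f y| / ω (euclNorm (x - y)) ≤ lipNorm euclNorm ω f := by
  have hpos := euclNorm_pos (sub_ne_zero.2 hxy)
  have hb : BddAbove {a : ℝ | ∃ t : ℝ, 0 < t ∧ a = modCont euclNorm f t / ω t} := by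
    refine ⟨C, ?_⟩
    rintro _ ⟨t, ht, rfl⟩
    rw [div_le_iff₀ (hω.pos ht)]
    exact modCont_le_mul hω hC ht h
  refine le_trans ?_ (le_csSup hb ⟨_, hpos, rfl⟩)
  refine div_le_div_of_nonneg_right ?_ (hω.pos hpos).le
  refine le_csSup ⟨C * ω (euclNorm (x - y)), ?_⟩ ⟨x, y, le_rfl, rfl⟩
  rintro _ ⟨z, w, hzw, rfl⟩
  exact (h z w).trans (mul_le_mul_of_nonneg_left (hω.le_of_le (euclNorm_nonneg _) hzw) hC)

lemma continuous_of_abs_sub_le (hω : IsModulus ω)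
    (h : ∀ x y, |f x - f y| ≤ ω (euclNorm (x - y))) : Continuous f := by
  rw [continuous_iff_continuousAt]
  intro x
  rw [ContinuousAt, tendsto_iff_dist_tendsto_zero]
  have hc : Continuous fun y => ω (euclNorm (y - x)) :=
    hω.continuous_comp (continuous_euclNorm.comp (continuous_sub_right x))
      fun y => euclNorm_nonneg _
  have := hc.tendsto x
  simp only [sub_self, euclNorm_zero, hω.map_zero] at this
  exact squeeze_zero (fun _ => dist_nonneg) (fun y => h y x) this

end Euclidean

section UpperBound

variable {d : ℕ} {ω : ℝ → ℝ} {f : (Fin d → ℝ) → ℝ} {K : ℝ}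

lemma exists_ball_average_le (hω : IsModulus ω)
    (hf : ∀ x y, |f x - f y| ≤ ω (euclNorm (x - y))) (hK0 : 0 ≤ K)
    (hK : ∀ e : EuclideanSpace ℝ (Fin d), ‖e‖ = 1 → ∀ s : ℝ, 0 < s →
      ∫ u, ω (s / 2 * ‖u + e‖) ∂unitBallMeasure (EuclideanSpace ℝ (Fin d)) ≤ K * ω s)
    (x y c : Fin d → ℝ) {R : ℝ} (hR : 0 < R) (hx : x ∈ nball euclNorm c R) :
    ∃ c' : Fin d → ℝ, ∃ R' : ℝ, 0 < R' ∧ y ∈ nball euclNorm c' R' ∧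
      ⨍ z in nball euclNorm c R, |f z| ≤
        (⨍ z in nball euclNorm c' R', |f z|) + K * ω (euclNorm (x - y)) := by
  have hpos := mul_nonneg hK0 (hω.nonneg _ (euclNorm_nonneg (x - y)))
  by_cases hy : euclNorm (y - c) ≤ R
  · exact ⟨c, R, hR, hy, by linarith⟩
  push Not at hy
  set w : EuclideanSpace ℝ (Fin d) := WithLp.toLp 2 (y - c) with hw
  rw [euclNorm_eq, ← hw] at hy
  have hw0 : 0 < ‖w‖ := hR.trans hy
  set s := ‖w‖ - R with hs
  have hs0 : 0 < s := by linarith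
  set e : EuclideanSpace ℝ (Fin d) := ‖w‖⁻¹ • w with he
  have he1 : ‖e‖ = 1 := by
    rw [he, norm_smul, norm_inv, norm_norm, inv_mul_cancel₀ hw0.ne']
  have hwe : y - c = ‖w‖ • e.ofLp := by
    rw [← WithLp.ofLp_smul, he, smul_inv_smul₀ hw0.ne']
  have hsxy : s ≤ euclNorm (x - y) := by
    have h1 : euclNorm (y - c) ≤ euclNorm (y - x) + euclNorm (x - c) := by
      simpa using euclNorm_add_le (y - x) (x - c)
    have h2 : euclNorm (x - c) ≤ R := hx
    rw [euclNorm_sub_comm y x, euclNorm_eq (y - c), ← hw] at h1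
    linarith
  have hR' : 0 < R + s / 2 := by linarith
  refine ⟨c + (s / 2) • e.ofLp, R + s / 2, hR', ?_, ?_⟩
  · change euclNorm _ ≤ _
    rw [show y - (c + (s / 2) • e.ofLp) = (‖w‖ - s / 2) • e.ofLp by
      rw [sub_smul, ← hwe]; abel, euclNorm_smul, euclNorm_ofLp, he1, mul_one,
      abs_of_nonneg (by linarith)]
    linarith
  · rw [setAverage_nball _ _ hR, setAverage_nball _ _ hR']
    have hfc := continuous_of_abs_sub_le hω hf
    have hωc : Continuous fun u : EuclideanSpace ℝ (Fin d) => ω (s / 2 * ‖u + e‖) :=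
      hω.continuous_comp (by fun_prop) fun u => by positivity
    have hi1 : Integrable (fun u : EuclideanSpace ℝ (Fin d) =>
        |f (c + (s / 2) • e.ofLp + (R + s / 2) • u.ofLp)|) (unitBallMeasure _) :=
      integrable_unitBallMeasure (by fun_prop)
    have hi2 := integrable_unitBallMeasure hωc
    have h1 := integral_mono_unitBallMeasure
      (g := fun u : EuclideanSpace ℝ (Fin d) => |f (c + R • u.ofLp)|) (by fun_prop)
      (hi1.add hi2) (fun u _ => by
        have h3 := hf (c + R • u.ofLp) (c + (s / 2) • e.ofLp + (R + s / 2) • u.ofLp)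
        have h4 : euclNorm (c + R • u.ofLp - (c + (s / 2) • e.ofLp + (R + s / 2) • u.ofLp)) =
            s / 2 * ‖u + e‖ := by
          rw [show c + R • u.ofLp - (c + (s / 2) • e.ofLp + (R + s / 2) • u.ofLp) =
            (-(s / 2)) • (u + e).ofLp by rw [WithLp.ofLp_add]; module, euclNorm_smul,
            euclNorm_ofLp, abs_neg, abs_of_pos (by linarith)]
        rw [h4] at h3
        have h5 := abs_sub_abs_le_abs_sub (f (c + R • u.ofLp))
          (f (c + (s / 2) • e.ofLp + (R + s / 2) • u.ofLp))
        simp only [Pi.add_apply]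
        linarith)
    simp only [Pi.add_apply] at h1
    rw [integral_add hi1 hi2] at h1
    have h6 := hK e he1 s hs0
    have h7 := mul_le_mul_of_nonneg_left (hω.le_of_le hs0.le hsxy) hK0
    linarith

lemma abs_maxFn_sub_le (hω : IsModulus ω)
    (hf : ∀ x y, |f x - f y| ≤ ω (euclNorm (x - y))) (hK0 : 0 ≤ K)
    (hK : ∀ e : EuclideanSpace ℝ (Fin d), ‖e‖ = 1 → ∀ s : ℝ, 0 < s →
      ∫ u, ω (s / 2 * ‖u + e‖) ∂unitBallMeasure (EuclideanSpace ℝ (Fin d)) ≤ K * ω s)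
    (x y : Fin d → ℝ) :
    |maxFn euclNorm f x - maxFn euclNorm f y| ≤ K * ω (euclNorm (x - y)) := by
  set A : (Fin d → ℝ) → Set ℝ := fun x => {a : ℝ | ∃ c : Fin d → ℝ, ∃ R : ℝ, 0 < R ∧
    x ∈ nball euclNorm c R ∧ a = ⨍ y in nball euclNorm c R, |f y|} with hA
  have hstep : ∀ x y, ∀ a ∈ A x, ∃ b ∈ A y, a ≤ b + K * ω (euclNorm (x - y)) := by
    rintro x y _ ⟨c, R, hR, hx, rfl⟩
    obtain ⟨c', R', hR', hy, h⟩ := exists_ball_average_le hω hf hK0 hK x y c hR hx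
    exact ⟨_, ⟨c', R', hR', hy, rfl⟩, h⟩
  have hne : ∀ x, (A x).Nonempty := fun x =>
    ⟨_, x, 1, one_pos, by simp [nball, euclNorm_zero], rfl⟩
  have hbdd : ∀ x y, BddAbove (A y) → BddAbove (A x) := by
    rintro x y ⟨M, hM⟩
    refine ⟨M + K * ω (euclNorm (x - y)), fun a ha => ?_⟩
    obtain ⟨b, hb, hab⟩ := hstep x y a ha
    linarith [hM hb]
  by_cases hb : BddAbove (A x)
  · have hle : ∀ x y, BddAbove (A y) →
        sSup (A x) ≤ sSup (A y) + K * ω (euclNorm (x - y)) := by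
      intro x y hb
      refine csSup_le (hne x) fun a ha => ?_
      obtain ⟨b, hb', hab⟩ := hstep x y a ha
      linarith [le_csSup hb hb']
    have h1 := hle x y (hbdd y x hb)
    have h2 := hle y x hb
    rw [euclNorm_sub_comm y x] at h2
    change |sSup (A x) - sSup (A y)| ≤ _
    rw [abs_le]
    constructor <;> linarith
  · have hb' : ¬ BddAbove (A y) := fun h => hb (hbdd x y h)
    change |sSup (A x) - sSup (A y)| ≤ _
    rw [Real.sSup_of_not_bddAbove hb, Real.sSup_of_not_bddAbove hb', sub_self, abs_zero]
    exact mul_nonneg hK0 (hω.nonneg _ (euclNorm_nonneg _))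

lemma op2_le_of_integral_le (hω : IsModulus ω) (hK0 : 0 ≤ K)
    (hK : ∀ e : EuclideanSpace ℝ (Fin d), ‖e‖ = 1 → ∀ s : ℝ, 0 < s →
      ∫ u, ω (s / 2 * ‖u + e‖) ∂unitBallMeasure (EuclideanSpace ℝ (Fin d)) ≤ K * ω s) :
    op2 ω d ≤ K := by
  refine Real.sSup_le ?_ hK0
  rintro _ ⟨f, hf, rfl⟩
  exact lipNorm_le hω hK0
    (abs_maxFn_sub_le hω (abs_sub_le_of_lipNorm_eq_one hω hf) hK0 hK)

lemma integral_modulus_le (hω : IsModulus ω) (e : EuclideanSpace ℝ (Fin d)) (he : ‖e‖ = 1)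
    (s : ℝ) (hs : 0 < s) :
    ∫ u, ω (s / 2 * ‖u + e‖) ∂unitBallMeasure (EuclideanSpace ℝ (Fin d)) ≤ 1 * ω s := by
  refine (integral_mono_unitBallMeasure (h := fun _ => ω s)
    (hω.continuous_comp (by fun_prop) fun u => by positivity)
    (integrable_const _) fun u hu => ?_).trans (by simp)
  have := norm_add_le u e
  exact hω.le_of_le (by positivity) (by nlinarith)

lemma op2_le_one (hω : IsModulus ω) : op2 ω d ≤ 1 :=
  op2_le_of_integral_le hω zero_le_one (integral_modulus_le hω)

lemma norm_add_sq_le {E : Type*} [NormedAddCommGroup E] [InnerProductSpace ℝ E] {u e : E}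
    (hu : ‖u‖ ≤ 1) (he : ‖e‖ = 1) : ‖u + e‖ ^ 2 ≤ 2 + 2 * inner ℝ e u := by
  have h := norm_add_sq_real u e
  rw [real_inner_comm, he] at h
  nlinarith [norm_nonneg u]

lemma op2_le_of_concaveOn (hω : IsModulus ω) (hc : ConcaveOn ℝ (Ici 0) ω) (hK0 : 0 ≤ K)
    (hK : ∀ s, 0 < s → ω (s / Real.sqrt 2) ≤ K * ω s) : op2 ω d ≤ K := by
  refine op2_le_of_integral_le hω hK0 fun e he s hs => ?_
  refine le_trans ?_ (hK s hs)
  have hg : Continuous fun u : EuclideanSpace ℝ (Fin d) => s / 2 * ‖u + e‖ := by fun_prop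
  have h0 : ∀ u : EuclideanSpace ℝ (Fin d), 0 ≤ s / 2 * ‖u + e‖ := fun u => by positivity
  have hJ := hc.le_map_integral (μ := unitBallMeasure (EuclideanSpace ℝ (Fin d))) hω.cont
    isClosed_Ici (ae_of_all _ h0) (integrable_unitBallMeasure hg)
    (integrable_unitBallMeasure (hω.continuous_comp hg h0))
  refine hJ.trans (hω.le_of_le (integral_nonneg h0) ?_)
  have h2 : (0 : ℝ) < Real.sqrt 2 := by positivity
  have h22 : Real.sqrt 2 * Real.sqrt 2 = 2 := Real.mul_self_sqrt zero_le_two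
  have hi : Integrable (fun u : EuclideanSpace ℝ (Fin d) =>
      s / Real.sqrt 2 + s / (2 * Real.sqrt 2) * inner ℝ e u) (unitBallMeasure _) :=
    integrable_unitBallMeasure (by fun_prop)
  refine (integral_mono_unitBallMeasure hg hi fun u hu => ?_).trans ?_
  · have h3 := norm_add_sq_le hu he
    have h4 : 2 * Real.sqrt 2 * ‖u + e‖ ≤ 4 + 2 * inner ℝ e u := by
      nlinarith [sq_nonneg (‖u + e‖ - Real.sqrt 2)]
    have h5 : s / Real.sqrt 2 + s / (2 * Real.sqrt 2) * inner ℝ e u - s / 2 * ‖u + e‖ =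
        s / (4 * Real.sqrt 2) * (4 + 2 * inner ℝ e u - 2 * Real.sqrt 2 * ‖u + e‖) := by
      field_simp
      ring
    have h6 : 0 ≤ s / (4 * Real.sqrt 2) * (4 + 2 * inner ℝ e u - 2 * Real.sqrt 2 * ‖u + e‖) :=
      mul_nonneg (by positivity) (by linarith)
    linarith
  · rw [integral_add (integrable_const _) (integrable_unitBallMeasure (by fun_prop)),
      integral_const_mul, integral_inner_unitBallMeasure]
    simp

lemma op2_le_add (hω : IsModulus ω) (hK0 : 0 ≤ K) {r : ℝ} (hr : 1 < r) (hd : 1 ≤ d)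
    (hK : ∀ s, 0 < s → ω (r * s / Real.sqrt 2) ≤ K * ω s) :
    op2 ω d ≤ K + 1 / (r ^ 2 - 1) ^ 2 / d := by
  have hr0 : 0 < r ^ 2 - 1 := by nlinarith
  refine op2_le_of_integral_le hω (by positivity) fun e he s hs => ?_
  have hi : Integrable (fun u : EuclideanSpace ℝ (Fin d) =>
      K * ω s + ω s / (r ^ 2 - 1) ^ 2 * (inner ℝ e u) ^ 2) (unitBallMeasure _) :=
    integrable_unitBallMeasure (by fun_prop)
  have hs' := hω.nonneg s hs.le
  refine (integral_mono_unitBallMeasure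
    (hω.continuous_comp (by fun_prop) fun u => by positivity) hi fun u hu => ?_).trans ?_
  · have h3 := norm_add_sq_le hu he
    by_cases hcase : inner ℝ e u ≤ r ^ 2 - 1
    · have h4 : s / 2 * ‖u + e‖ ≤ r * s / Real.sqrt 2 := by
        have h5 : ‖u + e‖ ≤ Real.sqrt 2 * r := by
          refine abs_le_of_sq_le_sq' ?_ (by positivity) |>.2
          rw [mul_pow, Real.sq_sqrt zero_le_two]
          linarith
        have h6 : r * s / Real.sqrt 2 = s / 2 * (Real.sqrt 2 * r) := by
          field_simp
          rw [Real.sq_sqrt zero_le_two]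
        rw [h6]
        gcongr
      have h7 : 0 ≤ ω s / (r ^ 2 - 1) ^ 2 * (inner ℝ e u) ^ 2 := by positivity
      linarith [hω.le_of_le (by positivity) h4, hK s hs]
    · push Not at hcase
      have h4 : ω (s / 2 * ‖u + e‖) ≤ ω s := by
        have := norm_add_le u e
        exact hω.le_of_le (by positivity) (by nlinarith)
      have h5 : 1 * ω s ≤ ω s / (r ^ 2 - 1) ^ 2 * (inner ℝ e u) ^ 2 := by
        rw [div_mul_eq_mul_div, le_div_iff₀ (by positivity), one_mul]
        gcongr
      have h6 : 0 ≤ K * ω s := by positivity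
      linarith
  · rw [integral_add (integrable_const _) (integrable_unitBallMeasure (by fun_prop)),
      integral_const, probReal_univ, one_smul, integral_const_mul]
    have h1 := integral_inner_sq_unitBallMeasure_le he
    rw [finrank_euclideanSpace_fin] at h1
    have h2 := mul_le_mul_of_nonneg_left h1
      (show 0 ≤ ω s / (r ^ 2 - 1) ^ 2 by positivity)
    refine (add_le_add_right h2 _).trans (le_of_eq ?_)
    ring

end UpperBound

section LowerBound

variable {d : ℕ} {ω : ℝ → ℝ}

/-- The truncated cusp `(ω(t) - ω(|x|))₊`. -/
noncomputable def cusp (ω : ℝ → ℝ) (t : ℝ) (x : Fin d → ℝ) : ℝ :=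
  max 0 (ω t - ω (euclNorm x))

lemma abs_cusp_sub_le (hω : IsModulus ω) (t : ℝ) (x y : Fin d → ℝ) :
    |cusp ω t x - cusp ω t y| ≤ ω (euclNorm (x - y)) := by
  have h1 : euclNorm x ≤ euclNorm y + euclNorm (x - y) := by
    simpa using euclNorm_add_le y (x - y)
  have h2 : euclNorm y ≤ euclNorm x + euclNorm (x - y) := by
    have := euclNorm_add_le x (y - x)
    rw [euclNorm_sub_comm y x] at this
    simpa using this
  have h3 := hω.sub_le (euclNorm_nonneg _) (euclNorm_nonneg _) (euclNorm_nonneg _) h1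
  have h4 := hω.sub_le (euclNorm_nonneg _) (euclNorm_nonneg _) (euclNorm_nonneg _) h2
  have h := abs_max_sub_max_le_abs (ω t - ω (euclNorm x)) (ω t - ω (euclNorm y)) 0
  unfold cusp
  rw [max_comm 0, max_comm 0]
  refine h.trans (abs_le.2 ⟨?_, ?_⟩) <;> linarith

lemma exists_norm_eq_one (hd : 1 ≤ d) : ∃ e : EuclideanSpace ℝ (Fin d), ‖e‖ = 1 :=
  ⟨EuclideanSpace.single ⟨0, hd⟩ 1, by simp⟩

lemma exists_eq_norm_smul (hd : 1 ≤ d) (v : EuclideanSpace ℝ (Fin d)) :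
    ∃ e : EuclideanSpace ℝ (Fin d), ‖e‖ = 1 ∧ v = ‖v‖ • e := by
  rcases eq_or_ne v 0 with rfl | hv
  · obtain ⟨e, he⟩ := exists_norm_eq_one hd
    exact ⟨e, he, by simp⟩
  · have := norm_ne_zero_iff.2 hv
    exact ⟨‖v‖⁻¹ • v, by rw [norm_smul, norm_inv, norm_norm, inv_mul_cancel₀ this],
      (smul_inv_smul₀ this v).symm⟩

lemma lipNorm_cusp (hω : IsModulus ω) (hd : 1 ≤ d) {t : ℝ} (ht : 0 < t) :
    lipNorm euclNorm ω (cusp ω t : (Fin d → ℝ) → ℝ) = 1 := by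
  have hle : ∀ x y : Fin d → ℝ, |cusp ω t x - cusp ω t y| ≤ 1 * ω (euclNorm (x - y)) := by
    simpa using abs_cusp_sub_le hω t
  refine le_antisymm (lipNorm_le hω zero_le_one hle) ?_
  obtain ⟨e, he⟩ := exists_norm_eq_one hd
  have hn : euclNorm (t • e.ofLp) = t := by
    rw [euclNorm_smul, euclNorm_ofLp, he, abs_of_pos ht, mul_one]
  have hne : t • e.ofLp ≠ 0 := by
    intro h
    rw [h, euclNorm_zero] at hn
    exact ht.ne hn
  have h := le_lipNorm hω zero_le_one hle hne
  rw [sub_zero, hn] at h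
  simp only [cusp, hn, euclNorm_zero, hω.map_zero, sub_self, sub_zero, max_self, zero_sub,
    abs_neg, max_eq_right (hω.nonneg t ht.le), abs_of_pos (hω.pos ht),
    div_self (hω.pos ht).ne'] at h
  exact h

lemma sq_norm_add_smul_ge {E : Type*} [NormedAddCommGroup E] [InnerProductSpace ℝ E]
    {e u : E} (he : ‖e‖ = 1) {a ρ δ : ℝ} (hu : 1 - δ ≤ ‖u‖ ^ 2) (hδ : 0 ≤ δ)
    (heu : |inner ℝ e u| ≤ δ) :
    (1 - 2 * δ) * (a ^ 2 + ρ ^ 2) ≤ ‖a • e + ρ • u‖ ^ 2 := by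
  rw [norm_add_sq_real, norm_smul, norm_smul, inner_smul_left, inner_smul_right, he, mul_pow,
    mul_pow, Real.norm_eq_abs, Real.norm_eq_abs, sq_abs, sq_abs]
  simp only [conj_trivial]
  have h1 : -(δ * (a ^ 2 + ρ ^ 2)) ≤ 2 * (a * (ρ * inner ℝ e u)) := by
    have h2 := abs_mul (2 * a * ρ) (inner ℝ e u)
    have h3 : |2 * a * ρ| ≤ a ^ 2 + ρ ^ 2 := by
      rw [abs_le]
      constructor <;> nlinarith [sq_nonneg (a + ρ), sq_nonneg (a - ρ)]
    have h4 : |2 * a * ρ| * |inner ℝ e u| ≤ (a ^ 2 + ρ ^ 2) * δ := by gcongr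
    have h5 := neg_abs_le (2 * a * ρ * inner ℝ e u)
    nlinarith
  nlinarith [mul_le_mul_of_nonneg_left hu (sq_nonneg ρ), mul_nonneg hδ (sq_nonneg a)]

lemma average_cusp_le (hω : IsModulus ω) (hd : 1 ≤ d) {t δ : ℝ} (ht : 0 < t) (hδ : 0 < δ)
    (hδ' : δ < 1 / 2) (c y : Fin d → ℝ) {R : ℝ} (hR : 0 < R) (hyt : euclNorm y = t)
    (hy : y ∈ nball euclNorm c R) :
    ⨍ z in nball euclNorm c R, |cusp ω t z| ≤
      ω t - ω (Real.sqrt (1 - 2 * δ) * (t / Real.sqrt 2)) *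
        (1 - Real.sqrt (1 - δ) ^ d - 1 / δ ^ 2 / d) := by
  set W := ω (Real.sqrt (1 - 2 * δ) * (t / Real.sqrt 2)) with hW
  have hW0 : 0 ≤ W := hω.nonneg _ (by positivity)
  have hWt : W ≤ ω t := by
    refine hω.le_of_le (by positivity) ?_
    have h1 : Real.sqrt (1 - 2 * δ) ≤ 1 := Real.sqrt_le_one.2 (by linarith)
    have h2 : t / Real.sqrt 2 ≤ t :=
      div_le_self ht.le (Real.one_le_sqrt.2 one_le_two)
    have h3 : 0 ≤ t / Real.sqrt 2 := by positivity
    nlinarith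
  have hωt := hω.nonneg t ht.le
  obtain ⟨e, he, hc⟩ := exists_eq_norm_smul hd (WithLp.toLp 2 c)
  set a := ‖(WithLp.toLp 2 c : EuclideanSpace ℝ (Fin d))‖ with ha
  have hat : t ≤ a + R := by
    have h1 : euclNorm y ≤ euclNorm c + euclNorm (y - c) := by
      simpa using euclNorm_add_le c (y - c)
    have h2 : euclNorm (y - c) ≤ R := hy
    rw [euclNorm_eq c, hyt] at h1
    linarith
  have ha0 : 0 ≤ a := norm_nonneg _
  rw [setAverage_nball _ _ hR]
  set s := Real.sqrt (1 - δ) with hs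
  have hs0 : 0 ≤ s := Real.sqrt_nonneg _
  have hs2 : s ^ 2 = 1 - δ := Real.sq_sqrt (by linarith)
  have hs1 : s ≤ 1 := Real.sqrt_le_one.2 (by linarith)
  let B : Set (EuclideanSpace ℝ (Fin d)) := Metric.closedBall 0 s
  have hB : MeasurableSet B := Metric.isClosed_closedBall.measurableSet
  have hi1 : Integrable (fun u => W * B.indicator (fun _ => (1 : ℝ)) u)
      (unitBallMeasure (EuclideanSpace ℝ (Fin d))) :=
    ((integrable_const 1).indicator hB).const_mul W
  have hi2 : Integrable (fun u : EuclideanSpace ℝ (Fin d) => W / δ ^ 2 * (inner ℝ e u) ^ 2)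
      (unitBallMeasure _) := integrable_unitBallMeasure (by fun_prop)
  have hfc := continuous_of_abs_sub_le hω (abs_cusp_sub_le (d := d) hω t)
  refine (integral_mono_unitBallMeasure (by fun_prop)
    (((integrable_const (ω t - W)).add hi1).add hi2) fun u _ => ?_).trans ?_
  · simp only [Pi.add_apply]
    have hnn : 0 ≤ W / δ ^ 2 * (inner ℝ e u) ^ 2 := by positivity
    have hnn' : 0 ≤ W * B.indicator (fun _ => (1 : ℝ)) u :=
      mul_nonneg hW0 (indicator_nonneg (fun _ _ => zero_le_one) _)
    have hft : |cusp ω t (c + R • u.ofLp)| ≤ ω t := by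
      rw [cusp, abs_of_nonneg (le_max_left _ _)]
      exact max_le hωt (by linarith [hω.nonneg _ (euclNorm_nonneg (c + R • u.ofLp))])
    by_cases huB : u ∈ B
    · rw [indicator_of_mem huB]
      linarith
    by_cases heu : |inner ℝ e u| ≤ δ
    · have hus : s < ‖u‖ := by simpa [B] using huB
      have h1 := sq_norm_add_smul_ge (a := a) (ρ := R) he (by nlinarith : 1 - δ ≤ ‖u‖ ^ 2)
        hδ.le heu
      have h2 : euclNorm (c + R • u.ofLp) = ‖a • e + R • u‖ := by
        rw [euclNorm_eq, ← hc]
        rfl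
      have h3 : Real.sqrt (1 - 2 * δ) * (t / Real.sqrt 2) ≤ ‖a • e + R • u‖ := by
        refine abs_le_of_sq_le_sq' ?_ (norm_nonneg _) |>.2
        refine le_trans ?_ h1
        rw [mul_pow, div_pow, Real.sq_sqrt (by linarith), Real.sq_sqrt zero_le_two]
        refine mul_le_mul_of_nonneg_left ?_ (by linarith)
        nlinarith [sq_nonneg (a - R)]
      have h4 : |cusp ω t (c + R • u.ofLp)| ≤ ω t - W := by
        rw [cusp, abs_of_nonneg (le_max_left _ _), h2]
        have := hω.le_of_le (by positivity) h3
        exact max_le (by linarith) (by linarith)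
      linarith
    · push Not at heu
      have h1 : W * 1 ≤ W / δ ^ 2 * (inner ℝ e u) ^ 2 := by
        rw [div_mul_eq_mul_div, le_div_iff₀ (by positivity), mul_one, ← sq_abs (inner ℝ e u)]
        gcongr
      linarith
  · simp only [Pi.add_apply]
    have hi0 : Integrable (fun u => ω t - W + W * B.indicator (fun _ => (1 : ℝ)) u)
        (unitBallMeasure (EuclideanSpace ℝ (Fin d))) := (integrable_const _).add hi1
    rw [integral_add hi0 hi2, integral_add (integrable_const _) hi1,
      integral_const_mul, integral_const_mul, integral_indicator_const _ hB,
      unitBallMeasure_real_closedBall hs0 hs1, integral_const, probReal_univ, one_smul,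
      finrank_euclideanSpace_fin, smul_eq_mul, mul_one]
    have h1 := integral_inner_sq_unitBallMeasure_le he
    rw [finrank_euclideanSpace_fin] at h1
    have h2 := mul_le_mul_of_nonneg_left h1 (show 0 ≤ W / δ ^ 2 by positivity)
    refine (add_le_add_right h2 _).trans (le_of_eq ?_)
    ring

lemma le_maxFn_cusp_zero (hω : IsModulus ω) {t : ℝ} (ht : 0 < t) :
    ω t ≤ maxFn euclNorm (cusp ω t : (Fin d → ℝ) → ℝ) 0 := by
  have hωt := hω.nonneg t ht.le
  have hfc := continuous_of_abs_sub_le hω (abs_cusp_sub_le (d := d) hω t)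
  have hb : BddAbove {a : ℝ | ∃ c : Fin d → ℝ, ∃ R : ℝ, 0 < R ∧ 0 ∈ nball euclNorm c R ∧
      a = ⨍ y in nball euclNorm c R, |cusp ω t y|} := by
    refine ⟨ω t, ?_⟩
    rintro _ ⟨c, R, hR, -, rfl⟩
    rw [setAverage_nball _ _ hR]
    refine (integral_mono_unitBallMeasure (by fun_prop) (integrable_const (ω t))
      fun u _ => ?_).trans (by simp)
    rw [cusp, abs_of_nonneg (le_max_left _ _)]
    exact max_le hωt (by linarith [hω.nonneg _ (euclNorm_nonneg (c + R • u.ofLp))])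
  have hlow : ∀ R, 0 < R → ω t - ω R ≤ maxFn euclNorm (cusp ω t : (Fin d → ℝ) → ℝ) 0 := by
    intro R hR
    refine le_trans ?_ (le_csSup hb ⟨0, R, hR, by simp [nball, euclNorm_zero, hR.le], rfl⟩)
    rw [setAverage_nball _ _ hR]
    refine le_trans (by simp) (integral_mono_unitBallMeasure
      (g := fun _ => ω t - ω R) continuous_const
      (integrable_unitBallMeasure (by fun_prop)) fun u hu => ?_)
    refine le_trans ?_ (le_abs_self _)
    refine le_trans ?_ (le_max_right _ _)
    have : euclNorm (0 + R • u.ofLp) ≤ R := by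
      rw [zero_add, euclNorm_smul, euclNorm_ofLp, abs_of_pos hR]
      nlinarith
    linarith [hω.le_of_le (euclNorm_nonneg _) this]
  have hlim : Tendsto (fun R => ω t - ω R) (𝓝[>] 0) (𝓝 (ω t - 0)) := by
    refine tendsto_const_nhds.sub ?_
    have := (hω.cont 0 self_mem_Ici).mono_left (nhdsWithin_mono 0 Ioi_subset_Ici_self)
    rwa [hω.map_zero] at this
  rw [sub_zero] at hlim
  exact le_of_tendsto hlim (by filter_upwards [self_mem_nhdsWithin] with R hR using hlow R hR)

lemma le_op2 (hω : IsModulus ω) (hd : 1 ≤ d) {t δ : ℝ} (ht : 0 < t) (hδ : 0 < δ)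
    (hδ' : δ < 1 / 2) :
    ω (Real.sqrt (1 - 2 * δ) * (t / Real.sqrt 2)) *
      (1 - Real.sqrt (1 - δ) ^ d - 1 / δ ^ 2 / d) / ω t ≤ op2 ω d := by
  obtain ⟨e, he⟩ := exists_norm_eq_one hd
  set y := t • e.ofLp with hy
  have hn : euclNorm y = t := by
    rw [euclNorm_smul, euclNorm_ofLp, he, abs_of_pos ht, mul_one]
  have hne : 0 ≠ y := by
    intro h
    rw [← h, euclNorm_zero] at hn
    exact ht.ne hn
  have hMy : maxFn euclNorm (cusp ω t) y ≤
      ω t - ω (Real.sqrt (1 - 2 * δ) * (t / Real.sqrt 2)) *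
        (1 - Real.sqrt (1 - δ) ^ d - 1 / δ ^ 2 / d) := by
    refine csSup_le ⟨_, y, 1, one_pos, by simp [nball, euclNorm_zero], rfl⟩ ?_
    rintro _ ⟨c, R, hR, hyc, rfl⟩
    exact average_cusp_le hω hd ht hδ hδ' c y hR hn hyc
  have hM0 := le_maxFn_cusp_zero (d := d) hω ht
  have hlip : ∀ f : (Fin d → ℝ) → ℝ, lipNorm euclNorm ω f = 1 → ∀ x y,
      |maxFn euclNorm f x - maxFn euclNorm f y| ≤ 1 * ω (euclNorm (x - y)) := fun f hf =>
    abs_maxFn_sub_le hω (abs_sub_le_of_lipNorm_eq_one hω hf) zero_le_one (integral_modulus_le hω)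
  have hb : BddAbove {a : ℝ | ∃ f : (Fin d → ℝ) → ℝ, lipNorm euclNorm ω f = 1 ∧
      a = lipNorm euclNorm ω (maxFn euclNorm f)} := by
    refine ⟨1, ?_⟩
    rintro _ ⟨f, hf, rfl⟩
    exact lipNorm_le hω zero_le_one (hlip f hf)
  have hcusp := lipNorm_cusp hω hd ht
  refine le_trans ?_ (le_csSup hb ⟨cusp ω t, hcusp, rfl⟩)
  refine le_trans ?_ (le_lipNorm hω zero_le_one (hlip _ hcusp) hne)
  rw [zero_sub, show -y = (-1 : ℝ) • y by simp, euclNorm_smul, hn, abs_neg, abs_one, one_mul]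
  refine div_le_div_of_nonneg_right ?_ (hω.pos ht).le
  refine le_trans ?_ (le_abs_self _)
  linarith

lemma eventually_lt_op2 (hω : IsModulus ω) {t b : ℝ} (ht : 0 < t)
    (hb : b < ω (t / Real.sqrt 2) / ω t) : ∀ᶠ d in atTop, b < op2 ω d := by
  have h1 : Tendsto (fun δ => ω (Real.sqrt (1 - 2 * δ) * (t / Real.sqrt 2)) / ω t) (𝓝[>] 0)
      (𝓝 (ω (t / Real.sqrt 2) / ω t)) := by
    have hc : Continuous fun δ => ω (Real.sqrt (1 - 2 * δ) * (t / Real.sqrt 2)) / ω t :=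
      (hω.continuous_comp (by fun_prop) fun δ => by positivity).div_const _
    have := hc.tendsto 0
    simp only [mul_zero, sub_zero, Real.sqrt_one, one_mul] at this
    exact this.mono_left nhdsWithin_le_nhds
  obtain ⟨δ, hδb, hδ0, hδ1⟩ := ((h1.eventually_const_lt hb).and
    (Ioo_mem_nhdsGT (show (0 : ℝ) < 1 / 2 by norm_num))).exists
  have h2 : Tendsto (fun d : ℕ => ω (Real.sqrt (1 - 2 * δ) * (t / Real.sqrt 2)) *
      (1 - Real.sqrt (1 - δ) ^ d - 1 / δ ^ 2 / d) / ω t) atTop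
      (𝓝 (ω (Real.sqrt (1 - 2 * δ) * (t / Real.sqrt 2)) * (1 - 0 - 0) / ω t)) := by
    refine Tendsto.div_const (Tendsto.const_mul _ ((tendsto_const_nhds.sub ?_).sub ?_)) _
    · refine tendsto_pow_atTop_nhds_zero_of_lt_one (Real.sqrt_nonneg _) ?_
      rw [Real.sqrt_lt' one_pos]
      linarith
    · exact tendsto_const_div_atTop_nhds_zero_nat _
  rw [sub_zero, sub_zero, mul_one] at h2
  filter_upwards [h2.eventually_const_lt hδb, eventually_ge_atTop 1] with d hd1 hd
  exact hd1.trans_le (le_op2 hω hd ht hδ0 hδ1)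

end LowerBound

section Asymptotics

variable {ω : ℝ → ℝ}

lemma bddAbove_ratio_sqrt_two (hω : IsModulus ω) :
    BddAbove {c : ℝ | ∃ t : ℝ, 0 < t ∧ c = ω (t / Real.sqrt 2) / ω t} := by
  simpa only [div_eq_inv_mul _ (Real.sqrt 2)] using
    hω.bddAbove_ratio (q := (Real.sqrt 2)⁻¹) (by positivity)

lemma bddAbove_ratio_mul_sqrt_two (hω : IsModulus ω) {r : ℝ} (hr : 0 ≤ r) :
    BddAbove {c : ℝ | ∃ t : ℝ, 0 < t ∧ c = ω (r * t / Real.sqrt 2) / ω t} := by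
  simpa only [mul_div_right_comm] using
    hω.bddAbove_ratio (q := r / Real.sqrt 2) (by positivity)

lemma op2_nonneg (hω : IsModulus ω) (d : ℕ) : 0 ≤ op2 ω d := by
  refine Real.sSup_nonneg ?_
  rintro _ ⟨f, -, rfl⟩
  refine Real.sSup_nonneg ?_
  rintro _ ⟨t, ht, rfl⟩
  refine div_nonneg (Real.sSup_nonneg ?_) (hω.nonneg t ht.le)
  rintro _ ⟨x, y, -, rfl⟩
  exact abs_nonneg _

lemma eventually_lt_op2_of_lt_sSup (hω : IsModulus ω) {b : ℝ}
    (hb : b < sSup {c : ℝ | ∃ t : ℝ, 0 < t ∧ c = ω (t / Real.sqrt 2) / ω t}) :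
    ∀ᶠ d in atTop, b < op2 ω d := by
  have hne : {c : ℝ | ∃ t : ℝ, 0 < t ∧ c = ω (t / Real.sqrt 2) / ω t}.Nonempty :=
    ⟨_, 1, one_pos, rfl⟩
  obtain ⟨_, ⟨t, ht, rfl⟩, hbt⟩ := exists_lt_of_lt_csSup hne hb
  exact eventually_lt_op2 hω ht hbt

lemma sSup_le_liminf_op2 (hω : IsModulus ω) :
    sSup {c : ℝ | ∃ t : ℝ, 0 < t ∧ c = ω (t / Real.sqrt 2) / ω t} ≤
      liminf (fun d : ℕ => op2 ω d) atTop := by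
  refine le_of_forall_lt fun b hb => ?_
  obtain ⟨b', hbb', hb'⟩ := exists_between hb
  refine hbb'.trans_le (le_liminf_of_le ?_ ?_)
  · exact (isBoundedUnder_of ⟨1, fun d => op2_le_one hω⟩).isCoboundedUnder_ge
  · exact (eventually_lt_op2_of_lt_sSup hω hb').mono fun _ h => h.le

lemma limsup_op2_le (hω : IsModulus ω) :
    limsup (fun d : ℕ => op2 ω d) atTop ≤
      sInf {c : ℝ | ∃ r : ℝ, 1 < r ∧
        c = sSup {e : ℝ | ∃ t : ℝ, 0 < t ∧ e = ω (r * t / Real.sqrt 2) / ω t}} := by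
  refine le_csInf ⟨_, 2, one_lt_two, rfl⟩ ?_
  rintro _ ⟨r, hr, rfl⟩
  set K := sSup {e : ℝ | ∃ t : ℝ, 0 < t ∧ e = ω (r * t / Real.sqrt 2) / ω t} with hKdef
  have hr0 : 0 ≤ r := by linarith
  have hK : ∀ s, 0 < s → ω (r * s / Real.sqrt 2) ≤ K * ω s := fun s hs => by
    rw [← div_le_iff₀ (hω.pos hs)]
    exact le_csSup (bddAbove_ratio_mul_sqrt_two hω hr0) ⟨s, hs, rfl⟩
  have hK0 : 0 ≤ K := by
    refine Real.sSup_nonneg ?_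
    rintro _ ⟨t, ht, rfl⟩
    exact div_nonneg (hω.nonneg _ (by positivity)) (hω.nonneg _ ht.le)
  have hlim : Tendsto (fun d : ℕ => K + 1 / (r ^ 2 - 1) ^ 2 / d) atTop (𝓝 (K + 0)) :=
    tendsto_const_nhds.add (tendsto_const_div_atTop_nhds_zero_nat _)
  rw [add_zero] at hlim
  rw [← hlim.limsup_eq]
  refine limsup_le_limsup ?_ ?_ hlim.isBoundedUnder_le
  · filter_upwards [eventually_ge_atTop 1] with d hd using op2_le_add hω hK0 hr hd hK
  · exact (isBoundedUnder_of ⟨0, fun d => op2_nonneg hω d⟩).isCoboundedUnder_le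

lemma op2_le_sSup_of_concaveOn (hω : IsModulus ω) (hc : ConcaveOn ℝ (Ici 0) ω) (d : ℕ) :
    op2 ω d ≤ sSup {c : ℝ | ∃ t : ℝ, 0 < t ∧ c = ω (t / Real.sqrt 2) / ω t} := by
  refine op2_le_of_concaveOn hω hc ?_ fun s hs => ?_
  · refine Real.sSup_nonneg ?_
    rintro _ ⟨t, ht, rfl⟩
    exact div_nonneg (hω.nonneg _ (by positivity)) (hω.nonneg _ ht.le)
  · rw [← div_le_iff₀ (hω.pos hs)]
    exact le_csSup (bddAbove_ratio_sqrt_two hω) ⟨s, hs, rfl⟩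

lemma tendsto_op2_of_concaveOn (hω : IsModulus ω) (hc : ConcaveOn ℝ (Ici 0) ω) :
    Tendsto (fun d : ℕ => op2 ω d) atTop
      (𝓝 (sSup {c : ℝ | ∃ t : ℝ, 0 < t ∧ c = ω (t / Real.sqrt 2) / ω t})) := by
  refine tendsto_order.2 ⟨fun b hb => eventually_lt_op2_of_lt_sSup hω hb, fun b hb => ?_⟩
  exact Eventually.of_forall fun d => (op2_le_sSup_of_concaveOn hω hc d).trans_lt hb

lemma isModulus_rpow {α : ℝ} (h0 : 0 < α) (h1 : α ≤ 1) : IsModulus fun t : ℝ => t ^ α where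
  nonneg _ ht := Real.rpow_nonneg ht α
  map_zero := Real.zero_rpow h0.ne'
  mono _ ha _ _ hab := Real.rpow_le_rpow ha hab h0.le
  subadd _ _ ha hb := Real.rpow_add_le_add_rpow ha hb h0.le h1
  cont := (Real.continuous_rpow_const h0.le).continuousOn
  nontrivial := ⟨1, one_pos, by simp⟩

lemma sSup_rpow_ratio (α : ℝ) :
    sSup {c : ℝ | ∃ t : ℝ, 0 < t ∧ c = (t / Real.sqrt 2) ^ α / t ^ α} =
      (2 : ℝ) ^ (-(α / 2)) := by
  have h : ∀ t : ℝ, 0 < t → (t / Real.sqrt 2) ^ α / t ^ α = (2 : ℝ) ^ (-(α / 2)) := by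
    intro t ht
    have htα : t ^ α ≠ 0 := (Real.rpow_pos_of_pos ht α).ne'
    rw [Real.div_rpow ht.le (Real.sqrt_nonneg _), div_right_comm, div_self htα,
      Real.sqrt_eq_rpow, ← Real.rpow_mul zero_le_two, Real.rpow_neg zero_le_two, one_div]
    congr 2
    ring
  have hset : {c : ℝ | ∃ t : ℝ, 0 < t ∧ c = (t / Real.sqrt 2) ^ α / t ^ α} =
      {(2 : ℝ) ^ (-(α / 2))} := by
    ext c
    constructor
    · rintro ⟨t, ht, rfl⟩
      exact h t ht
    · rintro rfl
      exact ⟨1, one_pos, (h 1 one_pos).symm⟩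
  rw [hset, csSup_singleton]

end Asymptotics

/-- Asymptotics of the euclidean maximal operator norm on `Lip(ω)` as `d → ∞`:
(i) `liminf ≥ sup_{t>0} ω(t/√2)/ω(t)`; (ii) `limsup ≤ inf_{r>1} sup_{t>0} ω(rt/√2)/ω(t)`;
(iii) if `ω` is concave then `‖M_d‖ ≤ sup_{t>0} ω(t/√2)/ω(t)` for every `d ≥ 1` and the
limit exists and equals this value; in particular for `ω(t) = t^α`, `‖M_d‖ ≤ 2^{−α/2}` for
all `d ≥ 1` and `lim_{d→∞} ‖M_d‖ = 2^{−α/2}`. -/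
theorem stmt16 (ω : ℝ → ℝ) (hω : IsModulus ω) :
    (sSup {c : ℝ | ∃ t : ℝ, 0 < t ∧ c = ω (t / Real.sqrt 2) / ω t} ≤
      Filter.liminf (fun d : ℕ => op2 ω d) Filter.atTop) ∧
    (Filter.limsup (fun d : ℕ => op2 ω d) Filter.atTop ≤
      sInf {c : ℝ | ∃ r : ℝ, 1 < r ∧
        c = sSup {e : ℝ | ∃ t : ℝ, 0 < t ∧ e = ω (r * t / Real.sqrt 2) / ω t}}) ∧
    (ConcaveOn ℝ (Set.Ici 0) ω →
      (∀ d : ℕ, 1 ≤ d →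
        op2 ω d ≤ sSup {c : ℝ | ∃ t : ℝ, 0 < t ∧ c = ω (t / Real.sqrt 2) / ω t}) ∧
      Filter.Tendsto (fun d : ℕ => op2 ω d) Filter.atTop
        (nhds (sSup {c : ℝ | ∃ t : ℝ, 0 < t ∧ c = ω (t / Real.sqrt 2) / ω t}))) ∧
    (∀ α : ℝ, 0 < α → α ≤ 1 →
      (∀ d : ℕ, 1 ≤ d → op2 (fun t => t ^ α) d ≤ (2 : ℝ) ^ (-(α / 2))) ∧
      Filter.Tendsto (fun d : ℕ => op2 (fun t => t ^ α) d) Filter.atTop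
        (nhds ((2 : ℝ) ^ (-(α / 2))))) := by
  refine ⟨sSup_le_liminf_op2 hω, limsup_op2_le hω,
    fun hc => ⟨fun d _ => op2_le_sSup_of_concaveOn hω hc d, tendsto_op2_of_concaveOn hω hc⟩,
    fun α h0 h1 => ?_⟩
  have hα := isModulus_rpow h0 h1
  have hc := Real.concaveOn_rpow h0.le h1
  rw [← sSup_rpow_ratio α]
  exact ⟨fun d _ => op2_le_sSup_of_concaveOn hα hc d, tendsto_op2_of_concaveOn hα hc⟩
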